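/- arXiv:2006.09486 — 7 statements merged into one kernel-verified Lean document; each statement's English description precedes it below -/
import Mathlib

section
/- For every (w,φ) ∈ W × Φ and every N ∈ ℕ, the gradient with respect to w of the map u ↦ L_D(w_N(u,φ), φ), evaluated at u = w, equals the composition (I − α∇²_w L_S(w_0(w,φ),φ)) ∘ (I − α∇²_w L_S(w_1(w,φ),φ)) ∘ ··· ∘ (I − α∇²_w L_S(w_{N−1}(w,φ),φ)) applied to the vector ∇_w L_D(w_N(w,φ), φ) (the factor with index m = 0 is applied last). -/
noncomputable section

open scoped RealInnerProductSpace

abbrev Wsp (p : ℕ) := EuclideanSpace ℝ (Fin p)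

/-- Partial gradient in the first block of variables. -/
def gradW {p q : ℕ} (f : Wsp p × Wsp q → ℝ) (w : Wsp p) (φ : Wsp q) : Wsp p :=
  gradient (fun u => f (u, φ)) w

/-- Partial gradient in the second block of variables. -/
def gradPhi {p q : ℕ} (f : Wsp p × Wsp q → ℝ) (w : Wsp p) (φ : Wsp q) : Wsp q :=
  gradient (fun ψ => f (w, ψ)) φ

/-- Inner-loop gradient descent iterates. -/
def innerIter {p q : ℕ} (f : Wsp p × Wsp q → ℝ) (α : ℝ) : ℕ → Wsp p → Wsp q → Wsp p
  | 0, w, _ => w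
  | (m+1), w, φ => innerIter f α m w φ - α • gradW f (innerIter f α m w φ) φ

/-- Hessian in `w` of `f(·,φ)` at `w`, as a continuous linear map. -/
def hessW {p q : ℕ} (f : Wsp p × Wsp q → ℝ) (w : Wsp p) (φ : Wsp q) : Wsp p →L[ℝ] Wsp p :=
  fderiv ℝ (fun u => gradW f u φ) w

/-- Mixed second derivative `∇_φ∇_w f (w,φ)`, viewed as a linear map `W → Φ`. -/
def crossD {p q : ℕ} (f : Wsp p × Wsp q → ℝ) (w : Wsp p) (φ : Wsp q) : Wsp p →L[ℝ] Wsp q :=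
  ContinuousLinearMap.adjoint (fderiv ℝ (fun ψ => gradW f w ψ) φ)

/-- Ordered product `A a * A (a+1) * ⋯ * A (b-1)` (factor `A a` leftmost, i.e. applied last). -/
def prodIco {p : ℕ} (A : ℕ → (Wsp p →L[ℝ] Wsp p)) (a b : ℕ) : Wsp p →L[ℝ] Wsp p :=
  ((List.range (b - a)).map (fun k => A (a + k))).prod

/-- `f(·,φ)` is `μc`-strongly convex in `w`, for every `φ`. -/
def StrongConvexIn {p q : ℕ} (μc : ℝ) (f : Wsp p × Wsp q → ℝ) : Prop :=
  ∀ (w w' : Wsp p) (φ : Wsp q),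
    f (w', φ) ≥ f (w, φ) + ⟪w' - w, gradW f w φ⟫ + μc / 2 * ‖w - w'‖ ^ 2

/-- The (full) gradient of `f` is `L`-Lipschitz on `W × Φ` (Euclidean norms). -/
def GradLip {p q : ℕ} (L : ℝ) (f : Wsp p × Wsp q → ℝ) : Prop :=
  ∀ (w₁ w₂ : Wsp p) (φ₁ φ₂ : Wsp q),
    Real.sqrt (‖gradW f w₁ φ₁ - gradW f w₂ φ₂‖ ^ 2 + ‖gradPhi f w₁ φ₁ - gradPhi f w₂ φ₂‖ ^ 2)
      ≤ L * Real.sqrt (‖w₁ - w₂‖ ^ 2 + ‖φ₁ - φ₂‖ ^ 2)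

/-- `f` is `M`-Lipschitz on `W × Φ` (Euclidean norms). -/
def FunLip {p q : ℕ} (M : ℝ) (f : Wsp p × Wsp q → ℝ) : Prop :=
  ∀ (w₁ w₂ : Wsp p) (φ₁ φ₂ : Wsp q),
    |f (w₁, φ₁) - f (w₂, φ₂)| ≤ M * Real.sqrt (‖w₁ - w₂‖ ^ 2 + ‖φ₁ - φ₂‖ ^ 2)

/-- `(w,φ) ↦ ∇²_w f(w,φ)` is `ρ`-Lipschitz in operator norm. -/
def HessLip {p q : ℕ} (ρ : ℝ) (f : Wsp p × Wsp q → ℝ) : Prop :=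
  ∀ (w₁ w₂ : Wsp p) (φ₁ φ₂ : Wsp q),
    ‖hessW f w₁ φ₁ - hessW f w₂ φ₂‖ ≤ ρ * Real.sqrt (‖w₁ - w₂‖ ^ 2 + ‖φ₁ - φ₂‖ ^ 2)

/-- `(w,φ) ↦ ∇_φ∇_w f(w,φ)` is `τ`-Lipschitz in operator norm. -/
def CrossLip {p q : ℕ} (τ : ℝ) (f : Wsp p × Wsp q → ℝ) : Prop :=
  ∀ (w₁ w₂ : Wsp p) (φ₁ φ₂ : Wsp q),
    ‖crossD f w₁ φ₁ - crossD f w₂ φ₂‖ ≤ τ * Real.sqrt (‖w₁ - w₂‖ ^ 2 + ‖φ₁ - φ₂‖ ^ 2)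

theorem gradW_contDiff {p q : ℕ} (f : Wsp p × Wsp q → ℝ) (hf : ContDiff ℝ 2 f) (φ : Wsp q) :
    ContDiff ℝ 1 (fun u => gradW f u φ) := by
  have hg : ContDiff ℝ 2 (fun u : Wsp p => f (u, φ)) := by fun_prop
  have h1 : ContDiff ℝ 1 (fderiv ℝ (fun u : Wsp p => f (u, φ))) :=
    hg.fderiv_right (by norm_num)
  exact (InnerProductSpace.toDual ℝ (Wsp p)).symm.toContinuousLinearEquiv.contDiff.comp h1

theorem hessW_inner {p q : ℕ} (f : Wsp p × Wsp q → ℝ) (hf : ContDiff ℝ 2 f)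
    (x : Wsp p) (φ : Wsp q) (v y : Wsp p) :
    ⟪hessW f x φ v, y⟫ = fderiv ℝ (fderiv ℝ (fun u : Wsp p => f (u, φ))) x v y := by
  have hg : ContDiff ℝ 2 (fun u : Wsp p => f (u, φ)) := by fun_prop
  have h1 : ContDiff ℝ 1 (fderiv ℝ (fun u : Wsp p => f (u, φ))) :=
    hg.fderiv_right (by norm_num)
  have h2 : fderiv ℝ (fun u : Wsp p => f (u, φ)) =
      fun u => (InnerProductSpace.toDual ℝ (Wsp p)).toContinuousLinearEquiv (gradW f u φ) := by
    funext u
    simp [gradW, gradient]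
  have h3 := (gradW_contDiff f hf φ).differentiable (by norm_num) x
  have h4 := ((InnerProductSpace.toDual ℝ (Wsp p)).toContinuousLinearEquiv.hasFDerivAt.comp x
    h3.hasFDerivAt).fderiv
  rw [h2]
  erw [h4]
  simp [hessW]

theorem hessW_symm {p q : ℕ} (f : Wsp p × Wsp q → ℝ) (hf : ContDiff ℝ 2 f)
    (x : Wsp p) (φ : Wsp q) (v y : Wsp p) :
    ⟪hessW f x φ v, y⟫ = ⟪v, hessW f x φ y⟫ := by
  have hg : ContDiff ℝ 2 (fun u : Wsp p => f (u, φ)) := by fun_prop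
  rw [real_inner_comm (hessW f x φ y) v, hessW_inner f hf, hessW_inner f hf]
  exact (hg.contDiffAt (x := x)).isSymmSndFDerivAt (by simp) v y

theorem grad_step {p q : ℕ} (f : Wsp p × Wsp q → ℝ) (hf : ContDiff ℝ 2 f) (α : ℝ)
    (φ : Wsp q) (F : Wsp p → ℝ) (hF : Differentiable ℝ F) (x : Wsp p) :
    gradient (fun u => F (u - α • gradW f u φ)) x =
      (1 - α • hessW f x φ) (gradient F (x - α • gradW f x φ)) := by
  have h3 := ((gradW_contDiff f hf φ).differentiable (by norm_num) x).hasFDerivAt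
  have hT : HasFDerivAt (fun u : Wsp p => u - α • gradW f u φ)
      (ContinuousLinearMap.id ℝ (Wsp p) - α • hessW f x φ) x :=
    (hasFDerivAt_id x).sub (h3.const_smul α)
  have hc := (hF (x - α • gradW f x φ)).hasFDerivAt.comp x hT
  have hc' := hc.fderiv
  apply ext_inner_right ℝ
  intro v
  have e1 : ⟪gradient (fun u => F (u - α • gradW f u φ)) x, v⟫ =
      fderiv ℝ (fun u => F (u - α • gradW f u φ)) x v := by
    simp [gradient]
  have e2 : ∀ z, ⟪gradient F (x - α • gradW f x φ), z⟫ =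
      fderiv ℝ F (x - α • gradW f x φ) z := by
    intro z; simp [gradient]
  rw [e1]
  change fderiv ℝ (F ∘ fun u => u - α • gradW f u φ) x v = _
  rw [hc']
  have : ⟪(1 - α • hessW f x φ) (gradient F (x - α • gradW f x φ)), v⟫ =
      ⟪gradient F (x - α • gradW f x φ), v - α • hessW f x φ v⟫ := by
    simp [inner_sub_left, inner_sub_right, inner_smul_left, inner_smul_right, hessW_symm f hf]
  rw [this, e2]
  simp

theorem grad_iter {p q : ℕ} (f : Wsp p × Wsp q → ℝ) (hf : ContDiff ℝ 2 f) (α : ℝ)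
    (φ : Wsp q) (w : Wsp p) (N : ℕ) : ∀ (F : Wsp p → ℝ), Differentiable ℝ F →
    gradient (fun u => F (innerIter f α N u φ)) w =
      prodIco (fun m => 1 - α • hessW f (innerIter f α m w φ) φ) 0 N
        (gradient F (innerIter f α N w φ)) := by
  induction N with
  | zero => intro F _; simp [prodIco, innerIter]
  | succ n ih =>
    intro F hF
    have hd := (gradW_contDiff f hf φ).differentiable (by norm_num)
    have := ih (fun u => F (u - α • gradW f u φ)) (by fun_prop)
    simp only [innerIter]
    rw [this, grad_step f hf α φ F hF]
    simp [prodIco, List.range_succ]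

/-- Proposition 1, part 1: explicit form of the partial meta-gradient in `w`. -/
theorem anil_meta_gradient_w (p q : ℕ) (LS LD : Wsp p × Wsp q → ℝ)
    (hLS : ContDiff ℝ 2 LS) (hLD : ContDiff ℝ 2 LD)
    (α : ℝ) (hα : 0 < α) (N : ℕ) (w : Wsp p) (φ : Wsp q) :
    gradient (fun u => LD (innerIter LS α N u φ, φ)) w
      = prodIco (fun m => 1 - α • hessW LS (innerIter LS α m w φ) φ) 0 N
          (gradW LD (innerIter LS α N w φ) φ) := by
  exact grad_iter LS hLS α φ w N (fun u => LD (u, φ))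
    ((hLD.differentiable (by norm_num)).comp (by fun_prop))
end
end

section
/- For every (w,φ) ∈ W × Φ and every N ∈ ℕ, the gradient with respect to φ of the map ψ ↦ L_D(w_N(w,ψ), ψ), evaluated at ψ = φ, equals −α Σ_{m=0}^{N−1} ∇_φ∇_w L_S(w_m(w,φ),φ) [ (I − α∇²_w L_S(w_{m+1}(w,φ),φ)) ∘ (I − α∇²_w L_S(w_{m+2}(w,φ),φ)) ∘ ··· ∘ (I − α∇²_w L_S(w_{N−1}(w,φ),φ)) ∇_w L_D(w_N(w,φ),φ) ] + ∇_φ L_D(w_N(w,φ),φ), where in each summand the factor with index j = m+1 is applied last among the product factors. -/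
noncomputable section

open scoped RealInnerProductSpace

theorem aux_gradW_eq {p q : ℕ} (f : Wsp p × Wsp q → ℝ) (hf : ContDiff ℝ 2 f) (w : Wsp p)
    (φ : Wsp q) :
    gradW f w φ = (InnerProductSpace.toDual ℝ (Wsp p)).symm
      ((fderiv ℝ f (w, φ)).comp (ContinuousLinearMap.inl ℝ (Wsp p) (Wsp q))) := by
  have h1 : HasFDerivAt f (fderiv ℝ f (w, φ)) (w, φ) :=
    ((hf.differentiable (by norm_num)) (w, φ)).hasFDerivAt
  have h2 : HasFDerivAt (fun u => f (u, φ)) _ w := h1.comp w (hasFDerivAt_prodMk_left w φ)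
  unfold gradW gradient
  rw [h2.fderiv]

theorem aux_gradPhi_eq {p q : ℕ} (f : Wsp p × Wsp q → ℝ) (hf : ContDiff ℝ 2 f) (w : Wsp p)
    (φ : Wsp q) :
    gradPhi f w φ = (InnerProductSpace.toDual ℝ (Wsp q)).symm
      ((fderiv ℝ f (w, φ)).comp (ContinuousLinearMap.inr ℝ (Wsp p) (Wsp q))) := by
  have h1 : HasFDerivAt f (fderiv ℝ f (w, φ)) (w, φ) :=
    ((hf.differentiable (by norm_num)) (w, φ)).hasFDerivAt
  have h2 : HasFDerivAt (fun u => f (w, u)) _ φ := h1.comp φ (hasFDerivAt_prodMk_right w φ)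
  unfold gradPhi gradient
  rw [h2.fderiv]

theorem aux_inner_gradW {p q : ℕ} (f : Wsp p × Wsp q → ℝ) (hf : ContDiff ℝ 2 f) (w v : Wsp p)
    (φ : Wsp q) : ⟪gradW f w φ, v⟫ = fderiv ℝ f (w, φ) (v, 0) := by
  rw [aux_gradW_eq f hf, InnerProductSpace.toDual_symm_apply]
  simp

theorem aux_inner_gradPhi {p q : ℕ} (f : Wsp p × Wsp q → ℝ) (hf : ContDiff ℝ 2 f) (w : Wsp p)
    (φ v : Wsp q) : ⟪gradPhi f w φ, v⟫ = fderiv ℝ f (w, φ) (0, v) := by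
  rw [aux_gradPhi_eq f hf, InnerProductSpace.toDual_symm_apply]
  simp

theorem aux_diff {p q : ℕ} (f : Wsp p × Wsp q → ℝ) (hf : ContDiff ℝ 2 f) :
    Differentiable ℝ (fun z : Wsp p × Wsp q => gradW f z.1 z.2) := by
  have h1 : Differentiable ℝ (fderiv ℝ f) :=
    (hf.fderiv_right (m := 1) (by norm_num)).differentiable (by norm_num)
  have h : (fun z : Wsp p × Wsp q => gradW f z.1 z.2) = fun z =>
      (InnerProductSpace.toDual ℝ (Wsp p)).symm
      ((fderiv ℝ f z).comp (ContinuousLinearMap.inl ℝ (Wsp p) (Wsp q))) := by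
    funext z
    exact aux_gradW_eq f hf z.1 z.2
  rw [h]
  have h3 : Differentiable ℝ (fun z =>
      (fderiv ℝ f z).comp (ContinuousLinearMap.inl ℝ (Wsp p) (Wsp q))) :=
    h1.clm_comp (differentiable_const _)
  exact (InnerProductSpace.toDual ℝ (Wsp p)).symm.differentiable.comp h3

theorem aux_hess_sym {p q : ℕ} (f : Wsp p × Wsp q → ℝ) (hf : ContDiff ℝ 2 f) (w : Wsp p)
    (φ : Wsp q) (a b : Wsp p) : ⟪hessW f w φ a, b⟫ = ⟪a, hessW f w φ b⟫ := by
  have hd : Differentiable ℝ (fun u => gradW f u φ) :=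
    (aux_diff f hf).comp (differentiable_id.prodMk (differentiable_const φ))
  have hg : ContDiff ℝ 2 (fun u : Wsp p => f (u, φ)) :=
    hf.comp (contDiff_id.prodMk contDiff_const)
  have hg1 : Differentiable ℝ (fderiv ℝ (fun u : Wsp p => f (u, φ))) :=
    (hg.fderiv_right (m := 1) (by norm_num)).differentiable (by norm_num)
  have key : ∀ a b, ⟪hessW f w φ a, b⟫
      = fderiv ℝ (fderiv ℝ (fun u : Wsp p => f (u, φ))) w a b := by
    intro a b
    have e : (fun u => ⟪gradW f u φ, b⟫) = fun u => fderiv ℝ (fun u : Wsp p => f (u, φ)) u b := by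
      funext u
      unfold gradW gradient
      rw [InnerProductSpace.toDual_symm_apply]
    have l1 : HasFDerivAt (fun u => ⟪gradW f u φ, b⟫) _ w :=
      (hd w).hasFDerivAt.inner ℝ (hasFDerivAt_const b w)
    have l2 : HasFDerivAt (fun u => fderiv ℝ (fun u : Wsp p => f (u, φ)) u b) _ w :=
      (hg1 w).hasFDerivAt.clm_apply (hasFDerivAt_const b w)
    rw [e] at l1
    have := congrArg (fun T => T a) (l1.unique l2)
    simpa [hessW] using this
  have sym : IsSymmSndFDerivAt ℝ (fun u : Wsp p => f (u, φ)) w :=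
    hg.contDiffAt.isSymmSndFDerivAt (by simp)
  rw [key, real_inner_comm, key]
  exact sym a b

theorem aux_prod_succ {p : ℕ} (A : ℕ → (Wsp p →L[ℝ] Wsp p)) (m n : ℕ) (h : m ≤ n) :
    prodIco A m (n + 1) = prodIco A m n * A n := by
  unfold prodIco
  rw [Nat.succ_sub h, List.range_succ]
  simp [Nat.add_sub_cancel' h]

theorem aux_iter {p q : ℕ} (f : Wsp p × Wsp q → ℝ) (hf : ContDiff ℝ 2 f) (α : ℝ) (w : Wsp p)
    (φ : Wsp q) (N : ℕ) : ∃ D : Wsp q →L[ℝ] Wsp p,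
    HasFDerivAt (fun ψ => innerIter f α N w ψ) D φ ∧
    ∀ v u, ⟪v, D u⟫ = ⟪-(α • ∑ m ∈ Finset.range N,
            crossD f (innerIter f α m w φ) φ
              (prodIco (fun j => 1 - α • hessW f (innerIter f α j w φ) φ) (m + 1) N v)), u⟫ := by
  induction N with
  | zero => exact ⟨0, hasFDerivAt_const w φ, by simp⟩
  | succ n ih =>
    obtain ⟨D, hD, ih⟩ := ih
    set x := innerIter f α n w φ with hx
    have hG : HasFDerivAt (fun z : Wsp p × Wsp q => gradW f z.1 z.2) _ (x, φ) :=
      (aux_diff f hf (x, φ)).hasFDerivAt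
    have hH : HasFDerivAt (fun u => gradW f u φ) _ x :=
      HasFDerivAt.comp (g := fun z : Wsp p × Wsp q => gradW f z.1 z.2)
        (f := fun u => (u, φ)) x hG (hasFDerivAt_prodMk_left x φ)
    have hC : HasFDerivAt (fun ψ => gradW f x ψ) _ φ :=
      HasFDerivAt.comp (g := fun z : Wsp p × Wsp q => gradW f z.1 z.2)
        (f := fun ψ => (x, ψ)) φ hG (hasFDerivAt_prodMk_right x φ)
    have hcomp : HasFDerivAt (fun ψ => gradW f (innerIter f α n w ψ) ψ) _ φ :=
      HasFDerivAt.comp (g := fun z : Wsp p × Wsp q => gradW f z.1 z.2)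
        (f := fun ψ => (innerIter f α n w ψ, ψ)) φ hG (hD.prodMk (hasFDerivAt_id φ))
    refine ⟨_, hD.sub (hcomp.const_smul α), ?_⟩
    intro v u
    have eC : ⟪crossD f x φ v, u⟫ = ⟪v, fderiv ℝ (fun z : Wsp p × Wsp q => gradW f z.1 z.2)
        (x, φ) (0, u)⟫ := by
      unfold crossD
      rw [hC.fderiv, ContinuousLinearMap.adjoint_inner_left]
      simp
    have eH : hessW f x φ (D u) = fderiv ℝ (fun z : Wsp p × Wsp q => gradW f z.1 z.2)
        (x, φ) (D u, 0) := by
      unfold hessW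
      rw [hH.fderiv]
      simp
    have esum : fderiv ℝ (fun z : Wsp p × Wsp q => gradW f z.1 z.2) (x, φ) (D u, u)
        = hessW f x φ (D u) + fderiv ℝ (fun z : Wsp p × Wsp q => gradW f z.1 z.2)
        (x, φ) (0, u) := by
      rw [eH, ← map_add]
      simp
    have ih' := ih ((1 - α • hessW f x φ) v) u
    have hs : ∑ m ∈ Finset.range (n + 1), crossD f (innerIter f α m w φ) φ
        (prodIco (fun j => 1 - α • hessW f (innerIter f α j w φ) φ) (m + 1) (n + 1) v)
        = ∑ m ∈ Finset.range n, crossD f (innerIter f α m w φ) φ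
        (prodIco (fun j => 1 - α • hessW f (innerIter f α j w φ) φ) (m + 1) n
          ((1 - α • hessW f x φ) v)) + crossD f x φ v := by
      rw [Finset.sum_range_succ]
      congr 1
      · apply Finset.sum_congr rfl
        intro m hm
        rw [aux_prod_succ _ _ _ (Finset.mem_range.mp hm)]
        rfl
      · simp [prodIco, hx]
    rw [hs, smul_add, neg_add, inner_add_left, ← ih', inner_neg_left, real_inner_smul_left, eC]
    have hL : ∀ T : Wsp p × Wsp q →L[ℝ] Wsp p,
        (D - α • T.comp (D.prod (ContinuousLinearMap.id ℝ (Wsp q)))) u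
          = D u - α • T (D u, u) := fun T => rfl
    rw [hL, esum]
    simp only [ContinuousLinearMap.sub_apply, ContinuousLinearMap.smul_apply,
      ContinuousLinearMap.one_apply, inner_sub_left, inner_sub_right, inner_add_right,
      real_inner_smul_left, real_inner_smul_right, aux_hess_sym f hf]
    ring

/-- Proposition 1, part 2: explicit form of the partial meta-gradient in `φ`. -/
theorem anil_meta_gradient_phi (p q : ℕ) (LS LD : Wsp p × Wsp q → ℝ)
    (hLS : ContDiff ℝ 2 LS) (hLD : ContDiff ℝ 2 LD)
    (α : ℝ) (hα : 0 < α) (N : ℕ) (w : Wsp p) (φ : Wsp q) :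
    gradient (fun ψ => LD (innerIter LS α N w ψ, ψ)) φ
      = -(α • ∑ m ∈ Finset.range N,
            crossD LS (innerIter LS α m w φ) φ
              (prodIco (fun j => 1 - α • hessW LS (innerIter LS α j w φ) φ) (m + 1) N
                (gradW LD (innerIter LS α N w φ) φ)))
        + gradPhi LD (innerIter LS α N w φ) φ := by
  obtain ⟨D, hD, hv⟩ := aux_iter LS hLS α w φ N
  have h1 : HasFDerivAt LD (fderiv ℝ LD (innerIter LS α N w φ, φ)) (innerIter LS α N w φ, φ) :=
    ((hLD.differentiable (by norm_num)) _).hasFDerivAt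
  have h2 : HasFDerivAt (fun ψ => LD (innerIter LS α N w ψ, ψ)) _ φ :=
    HasFDerivAt.comp (g := LD) (f := fun ψ => (innerIter LS α N w ψ, ψ)) φ h1
      (hD.prodMk (hasFDerivAt_id φ))
  refine ext_inner_right ℝ fun u => ?_
  rw [inner_add_left, ← hv, aux_inner_gradPhi LD hLD, aux_inner_gradW LD hLD, ← map_add]
  unfold gradient
  rw [InnerProductSpace.toDual_symm_apply, h2.fderiv]
  simp
end
end

section
/- If the gradient of L_S is L-Lipschitz on W × Φ, L_S(·,φ) is μ-strongly convex in w for every φ, and α > 0 satisfies 1 − 2αμ + α²L² ≥ 0, then for all (w₁,φ₁), (w₂,φ₂) ∈ W × Φ: ‖(w₁ − α∇_w L_S(w₁,φ₁)) − (w₂ − α∇_w L_S(w₂,φ₂))‖ ≤ √(1 − 2αμ + α²L²) · ‖w₁ − w₂‖ + αL‖φ₁ − φ₂‖. -/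
noncomputable section

open scoped RealInnerProductSpace

/-- one-step contraction of the inner-loop gradient descent map under
strong convexity and gradient Lipschitzness. -/
theorem anil_one_step_contraction (p q : ℕ) (LS : Wsp p × Wsp q → ℝ)
    (hLS : ContDiff ℝ 1 LS) (L μc α : ℝ)
    (hLip : GradLip L LS) (hSC : StrongConvexIn μc LS)
    (hα : 0 < α) (hcond : 0 ≤ 1 - 2 * α * μc + α ^ 2 * L ^ 2) :
    ∀ (w₁ w₂ : Wsp p) (φ₁ φ₂ : Wsp q),
      ‖(w₁ - α • gradW LS w₁ φ₁) - (w₂ - α • gradW LS w₂ φ₂)‖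
        ≤ Real.sqrt (1 - 2 * α * μc + α ^ 2 * L ^ 2) * ‖w₁ - w₂‖ + α * L * ‖φ₁ - φ₂‖ := by
  intro w₁ w₂ φ₁ φ₂
  have h1 : ‖gradW LS w₁ φ₁ - gradW LS w₂ φ₁‖ ≤ L * ‖w₁ - w₂‖ := by
    have h := hLip w₁ w₂ φ₁ φ₁
    have e : Real.sqrt (‖w₁ - w₂‖ ^ 2 + ‖φ₁ - φ₁‖ ^ 2) = ‖w₁ - w₂‖ := by
      simp
    rw [e] at h
    refine le_trans (Real.le_sqrt_of_sq_le ?_) h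
    exact le_add_of_nonneg_right (sq_nonneg _)
  have h2 : ‖gradW LS w₂ φ₁ - gradW LS w₂ φ₂‖ ≤ L * ‖φ₁ - φ₂‖ := by
    have h := hLip w₂ w₂ φ₁ φ₂
    have e : Real.sqrt (‖w₂ - w₂‖ ^ 2 + ‖φ₁ - φ₂‖ ^ 2) = ‖φ₁ - φ₂‖ := by
      simp
    rw [e] at h
    refine le_trans (Real.le_sqrt_of_sq_le ?_) h
    exact le_add_of_nonneg_right (sq_nonneg _)
  have hmono : μc * ‖w₁ - w₂‖ ^ 2 ≤ ⟪w₁ - w₂, gradW LS w₁ φ₁ - gradW LS w₂ φ₁⟫ := by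
    have a := hSC w₁ w₂ φ₁
    have b := hSC w₂ w₁ φ₁
    rw [norm_sub_rev w₂ w₁] at b
    rw [← neg_sub w₁ w₂, inner_neg_left] at a
    rw [inner_sub_right]
    linarith
  generalize gradW LS w₁ φ₁ = a at *
  generalize gradW LS w₂ φ₁ = b at *
  generalize gradW LS w₂ φ₂ = c at *
  have h3 : ‖(w₁ - w₂) - α • (a - b)‖
      ≤ Real.sqrt (1 - 2 * α * μc + α ^ 2 * L ^ 2) * ‖w₁ - w₂‖ := by
    refine abs_le_of_sq_le_sq' ?_ (by positivity) |>.2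
    rw [mul_pow, Real.sq_sqrt hcond, norm_sub_sq_real, inner_smul_right, norm_smul, mul_pow,
      Real.norm_eq_abs, sq_abs]
    have h4 : ‖a - b‖ ^ 2 ≤ (L * ‖w₁ - w₂‖) ^ 2 := pow_le_pow_left₀ (norm_nonneg _) h1 2
    have h5 := mul_le_mul_of_nonneg_left h4 (sq_nonneg α)
    have h6 := mul_le_mul_of_nonneg_left hmono hα.le
    linarith
  have e : (w₁ - α • a) - (w₂ - α • c) = ((w₁ - w₂) - α • (a - b)) - α • (b - c) := by
    module
  rw [e]
  refine (norm_sub_le _ _).trans (add_le_add h3 ?_)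
  rw [norm_smul, Real.norm_eq_abs, abs_of_pos hα, mul_assoc]
  exact mul_le_mul_of_nonneg_left h2 hα.le
end
end

section
/- Suppose the gradient of L_S is L-Lipschitz on W × Φ, L_S(·,φ) is μ-strongly convex in w for every φ, and α > 0 satisfies 0 < 1 − 2αμ + α²L² < 1. Then for every t ∈ ℕ and all (w₁,φ₁), (w₂,φ₂) ∈ W × Φ: ‖w_t(w₁,φ₁) − w_t(w₂,φ₂)‖ ≤ (1 − 2αμ + α²L²)^{t/2} ‖w₁ − w₂‖ + αL‖φ₁ − φ₂‖ / (1 − √(1 − 2αμ + α²L²)). -/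
noncomputable section

open scoped RealInnerProductSpace

/-- Lemma 1: contraction of the inner-loop iterates under a
strongly-convex inner-loop loss. -/
theorem anil_inner_iterates_contraction (p q : ℕ) (LS : Wsp p × Wsp q → ℝ)
    (hLS : ContDiff ℝ 1 LS) (L μc α : ℝ)
    (hLip : GradLip L LS) (hSC : StrongConvexIn μc LS) (hα : 0 < α)
    (hcond₀ : 0 < 1 - 2 * α * μc + α ^ 2 * L ^ 2)
    (hcond₁ : 1 - 2 * α * μc + α ^ 2 * L ^ 2 < 1) :
    ∀ (t : ℕ) (w₁ w₂ : Wsp p) (φ₁ φ₂ : Wsp q),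
      ‖innerIter LS α t w₁ φ₁ - innerIter LS α t w₂ φ₂‖
        ≤ (1 - 2 * α * μc + α ^ 2 * L ^ 2) ^ ((t : ℝ) / 2) * ‖w₁ - w₂‖
          + α * L * ‖φ₁ - φ₂‖ / (1 - Real.sqrt (1 - 2 * α * μc + α ^ 2 * L ^ 2)) := by
  intro t w₁ w₂ φ₁ φ₂
  set c := 1 - 2 * α * μc + α ^ 2 * L ^ 2 with hc
  set s := Real.sqrt c with hs
  have hs0 : 0 ≤ s := Real.sqrt_nonneg _
  have hss : s ^ 2 = c := Real.sq_sqrt hcond₀.le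
  have hs1 : s < 1 := by nlinarith
  have hpow : c ^ ((t : ℝ) / 2) = s ^ t := by
    rw [hs, Real.sqrt_eq_rpow, ← Real.rpow_natCast, ← Real.rpow_mul hcond₀.le]
    congr 1
    ring
  rw [hpow]
  have hg : ∀ (u v : Wsp p) (φ ψ : Wsp q), ‖gradW LS u φ - gradW LS v ψ‖
      ≤ L * Real.sqrt (‖u - v‖ ^ 2 + ‖φ - ψ‖ ^ 2) := by
    intro u v φ ψ
    refine le_trans (Real.le_sqrt_of_sq_le ?_) (hLip u v φ ψ)
    nlinarith [sq_nonneg ‖gradPhi LS u φ - gradPhi LS v ψ‖]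
  have hgw : ∀ (u v : Wsp p) (φ : Wsp q), ‖gradW LS u φ - gradW LS v φ‖ ≤ L * ‖u - v‖ := by
    intro u v φ
    simpa [Real.sqrt_sq (norm_nonneg (u - v))] using hg u v φ φ
  have hgp : ∀ (u : Wsp p), ‖gradW LS u φ₁ - gradW LS u φ₂‖ ≤ L * ‖φ₁ - φ₂‖ := by
    intro u
    simpa [Real.sqrt_sq (norm_nonneg (φ₁ - φ₂))] using hg u u φ₁ φ₂
  have hcontr : ∀ (u v : Wsp p) (φ : Wsp q),
      ‖(u - v) - α • (gradW LS u φ - gradW LS v φ)‖ ≤ s * ‖u - v‖ := by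
    intro u v φ
    have h1 := hSC u v φ
    have h2 := hSC v u φ
    have h3 : μc * ‖u - v‖ ^ 2 ≤ ⟪u - v, gradW LS u φ - gradW LS v φ⟫ := by
      rw [norm_sub_rev v u] at h2
      rw [← neg_sub u v, inner_neg_left] at h1
      rw [inner_sub_right]
      linarith
    have h4 : ‖gradW LS u φ - gradW LS v φ‖ ^ 2 ≤ L ^ 2 * ‖u - v‖ ^ 2 := by
      rw [← mul_pow]
      exact pow_le_pow_left₀ (norm_nonneg _) (hgw u v φ) 2
    refine (sq_le_sq₀ (norm_nonneg _) (by positivity)).1 ?_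
    rw [mul_pow, hss, norm_sub_sq_real, inner_smul_right, norm_smul, mul_pow, Real.norm_eq_abs,
      sq_abs]
    have h5 := mul_le_mul_of_nonneg_left h3 hα.le
    have h6 := mul_le_mul_of_nonneg_left h4 (sq_nonneg α)
    rw [hc]
    linarith
  have hD : 0 ≤ L * ‖φ₁ - φ₂‖ := (norm_nonneg _).trans (hgp w₁)
  have h1s : 0 < 1 - s := by linarith
  clear hpow
  induction t with
  | zero =>
    have : 0 ≤ α * L * ‖φ₁ - φ₂‖ / (1 - s) := by
      rw [mul_assoc]; positivity
    simpa [innerIter] using this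
  | succ t ih =>
    set u := innerIter LS α t w₁ φ₁ with hu
    set v := innerIter LS α t w₂ φ₂ with hv
    have e : innerIter LS α (t + 1) w₁ φ₁ - innerIter LS α (t + 1) w₂ φ₂
        = ((u - v) - α • (gradW LS u φ₁ - gradW LS v φ₁))
          - α • (gradW LS v φ₁ - gradW LS v φ₂) := by
      simp only [innerIter, ← hu, ← hv]
      module
    rw [e]
    refine (norm_sub_le _ _).trans ?_
    rw [norm_smul α, Real.norm_of_nonneg hα.le]
    have a1 := hcontr u v φ₁
    have a2 := mul_le_mul_of_nonneg_left (hgp v) hα.le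
    have a3 := mul_le_mul_of_nonneg_left ih hs0
    have a4 : α * L * ‖φ₁ - φ₂‖ / (1 - s)
        = s * (α * L * ‖φ₁ - φ₂‖ / (1 - s)) + α * (L * ‖φ₁ - φ₂‖) := by
      field_simp
      ring
    rw [a4, pow_succ]
    linarith
end
end

section
/- Suppose the gradients of L_S and L_D are L-Lipschitz on W × Φ, L_S(·,φ) is μ-strongly convex in w for every φ with 0 < μ < L, and α = μ/L². Then for every N ∈ ℕ and all (w₁,φ₁), (w₂,φ₂) ∈ W × Φ: ‖∇_w L_D(w_N(w₁,φ₁),φ₁) − ∇_w L_D(w_N(w₂,φ₂),φ₂)‖ ≤ L(1 − μ²/L²)^{N/2} ‖w₁ − w₂‖ + L(2L/μ + 1)‖φ₁ − φ₂‖. -/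
noncomputable section

open scoped RealInnerProductSpace

theorem gradW_le {p q : ℕ} {L : ℝ} (hL : 0 < L) {f : Wsp p × Wsp q → ℝ} (h : GradLip L f)
    (w₁ w₂ : Wsp p) (φ₁ φ₂ : Wsp q) :
    ‖gradW f w₁ φ₁ - gradW f w₂ φ₂‖ ≤ L * (‖w₁ - w₂‖ + ‖φ₁ - φ₂‖) := by
  have h1 := h w₁ w₂ φ₁ φ₂
  have h2 : ‖gradW f w₁ φ₁ - gradW f w₂ φ₂‖ ≤ Real.sqrt (‖gradW f w₁ φ₁ - gradW f w₂ φ₂‖ ^ 2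
      + ‖gradPhi f w₁ φ₁ - gradPhi f w₂ φ₂‖ ^ 2) := by
    apply Real.le_sqrt_of_sq_le
    nlinarith [sq_nonneg ‖gradPhi f w₁ φ₁ - gradPhi f w₂ φ₂‖]
  have h3 : Real.sqrt (‖w₁ - w₂‖ ^ 2 + ‖φ₁ - φ₂‖ ^ 2) ≤ ‖w₁ - w₂‖ + ‖φ₁ - φ₂‖ := by
    apply Real.sqrt_le_iff.mpr
    constructor
    · positivity
    · nlinarith [mul_nonneg (norm_nonneg (w₁ - w₂)) (norm_nonneg (φ₁ - φ₂))]
  exact h2.trans (h1.trans (mul_le_mul_of_nonneg_left h3 hL.le))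

theorem gradW_mono {p q : ℕ} {μc : ℝ} {f : Wsp p × Wsp q → ℝ} (h : StrongConvexIn μc f)
    (u v : Wsp p) (φ : Wsp q) :
    μc * ‖u - v‖ ^ 2 ≤ ⟪u - v, gradW f u φ - gradW f v φ⟫ := by
  have h1 := h u v φ
  have h2 := h v u φ
  rw [norm_sub_rev v u] at h2
  rw [← neg_sub u v, inner_neg_left] at h1
  rw [inner_sub_right]
  linarith

theorem step_contract {p q : ℕ} {L μc α : ℝ} (hμ : 0 < μc) (hL : 0 < L) (hα : α = μc / L ^ 2)
    {f : Wsp p × Wsp q → ℝ} (hf : GradLip L f) (h : StrongConvexIn μc f)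
    (u v : Wsp p) (φ : Wsp q) :
    ‖(u - v) - α • (gradW f u φ - gradW f v φ)‖ ≤ Real.sqrt (1 - μc ^ 2 / L ^ 2) * ‖u - v‖ := by
  have h1 := gradW_mono h u v φ
  have h2 := gradW_le hL hf u v φ φ
  rw [sub_self, norm_zero, add_zero] at h2
  have hα0 : 0 < α := by rw [hα]; positivity
  have key : ‖(u - v) - α • (gradW f u φ - gradW f v φ)‖ ^ 2
      ≤ (1 - μc ^ 2 / L ^ 2) * ‖u - v‖ ^ 2 := by
    rw [norm_sub_sq_real, inner_smul_right, norm_smul, mul_pow, Real.norm_eq_abs, sq_abs]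
    have h3 : ‖gradW f u φ - gradW f v φ‖ ^ 2 ≤ L ^ 2 * ‖u - v‖ ^ 2 := by
      rw [← mul_pow]; gcongr
    have h4 := mul_le_mul_of_nonneg_left h3 (sq_nonneg α)
    have h5 := mul_le_mul_of_nonneg_left h1 hα0.le
    have e1 : α ^ 2 * (L ^ 2 * ‖u - v‖ ^ 2) = μc ^ 2 / L ^ 2 * ‖u - v‖ ^ 2 := by
      rw [hα]; field_simp
    have e2 : α * (μc * ‖u - v‖ ^ 2) = μc ^ 2 / L ^ 2 * ‖u - v‖ ^ 2 := by
      rw [hα]; field_simp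
    linarith
  have := Real.sqrt_le_sqrt key
  rwa [Real.sqrt_sq (norm_nonneg _), Real.sqrt_mul' _ (sq_nonneg _),
    Real.sqrt_sq (norm_nonneg _)] at this

theorem iter_bound {p q : ℕ} {L μc α : ℝ} (hμ : 0 < μc) (hμL : μc < L) (hα : α = μc / L ^ 2)
    {f : Wsp p × Wsp q → ℝ} (hf : GradLip L f) (h : StrongConvexIn μc f)
    (N : ℕ) (w₁ w₂ : Wsp p) (φ₁ φ₂ : Wsp q) :
    ‖innerIter f α N w₁ φ₁ - innerIter f α N w₂ φ₂‖
      ≤ Real.sqrt (1 - μc ^ 2 / L ^ 2) ^ N * ‖w₁ - w₂‖ + 2 * L / μc * ‖φ₁ - φ₂‖ := by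
  have hL : 0 < L := hμ.trans hμL
  have hα0 : 0 < α := by rw [hα]; positivity
  induction N with
  | zero =>
    simp only [innerIter, pow_zero, one_mul]
    have : 0 ≤ 2 * L / μc * ‖φ₁ - φ₂‖ := by positivity
    linarith
  | succ m ih =>
    simp only [innerIter]
    generalize innerIter f α m w₁ φ₁ = u at *
    generalize innerIter f α m w₂ φ₂ = v at *
    have hs := step_contract hμ hL hα hf h u v φ₁
    have hg := gradW_le hL hf v v φ₁ φ₂
    rw [sub_self, norm_zero, zero_add] at hg
    have hc : 0 ≤ 1 - μc ^ 2 / L ^ 2 := by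
      rw [sub_nonneg, div_le_one (by positivity)]
      gcongr
    set r := Real.sqrt (1 - μc ^ 2 / L ^ 2) with hr
    have hr0 : 0 ≤ r := Real.sqrt_nonneg _
    have hr2 : r ^ 2 = 1 - μc ^ 2 / L ^ 2 := Real.sq_sqrt hc
    have hr1 : μc ^ 2 / L ^ 2 ≤ 2 * (1 - r) := by nlinarith [sq_nonneg (r - 1)]
    have hk : r * (2 * L / μc) + α * L ≤ 2 * L / μc := by
      have h6 := mul_le_mul_of_nonneg_left hr1 (by positivity : 0 ≤ L / μc)
      have e : L / μc * (μc ^ 2 / L ^ 2) = α * L := by rw [hα]; field_simp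
      have e2 : 2 * L / μc = 2 * (L / μc) := by ring
      rw [e] at h6
      rw [e2]
      linarith
    have e : u - α • gradW f u φ₁ - (v - α • gradW f v φ₂)
        = ((u - v) - α • (gradW f u φ₁ - gradW f v φ₁))
          - α • (gradW f v φ₁ - gradW f v φ₂) := by
      simp only [smul_sub]; abel
    rw [e]
    have h7 := norm_sub_le ((u - v) - α • (gradW f u φ₁ - gradW f v φ₁))
      (α • (gradW f v φ₁ - gradW f v φ₂))
    rw [norm_smul, Real.norm_eq_abs, abs_of_pos hα0] at h7
    have h8 := mul_le_mul_of_nonneg_left hg hα0.le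
    have h9 := mul_le_mul_of_nonneg_left ih hr0
    have h10 := mul_le_mul_of_nonneg_right hk (norm_nonneg (φ₁ - φ₂))
    rw [pow_succ]
    linarith

/-- Lipschitz-type bound for `∇_w L_D` evaluated along the inner-loop
iterates, under a strongly-convex inner-loop loss with `α = μ/L²`. -/
theorem anil_gradLD_along_iterates (p q : ℕ) (LS LD : Wsp p × Wsp q → ℝ)
    (hLS : ContDiff ℝ 1 LS) (hLD : ContDiff ℝ 1 LD) (L μc α : ℝ)
    (hLipS : GradLip L LS) (hLipD : GradLip L LD)
    (hSC : StrongConvexIn μc LS) (hμ : 0 < μc) (hμL : μc < L) (hα : α = μc / L ^ 2) :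
    ∀ (N : ℕ) (w₁ w₂ : Wsp p) (φ₁ φ₂ : Wsp q),
      ‖gradW LD (innerIter LS α N w₁ φ₁) φ₁ - gradW LD (innerIter LS α N w₂ φ₂) φ₂‖
        ≤ L * (1 - μc ^ 2 / L ^ 2) ^ ((N : ℝ) / 2) * ‖w₁ - w₂‖
          + L * (2 * L / μc + 1) * ‖φ₁ - φ₂‖ := by
  intro N w₁ w₂ φ₁ φ₂
  have hL : 0 < L := hμ.trans hμL
  have hc : 0 ≤ 1 - μc ^ 2 / L ^ 2 := by
    rw [sub_nonneg, div_le_one (by positivity)]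
    gcongr
  have h1 := iter_bound hμ hμL hα hLipS hSC N w₁ w₂ φ₁ φ₂
  have h2 := gradW_le hL hLipD (innerIter LS α N w₁ φ₁) (innerIter LS α N w₂ φ₂) φ₁ φ₂
  have e : (1 - μc ^ 2 / L ^ 2) ^ ((N : ℝ) / 2) = Real.sqrt (1 - μc ^ 2 / L ^ 2) ^ N := by
    rw [Real.sqrt_eq_rpow, ← Real.rpow_natCast _ N, ← Real.rpow_mul hc]
    congr 1
    ring
  rw [e]
  have h3 := mul_le_mul_of_nonneg_left h1 hL.le
  linarith
end
end

section
/- Suppose (A1) the gradients of L_S and L_D are L-Lipschitz on W × Φ, (A2) L_D is M-Lipschitz, (A3) (w,φ) ↦ ∇²_w L_S(w,φ) is ρ-Lipschitz in operator norm, (SC) L_S(·,φ) is μ-strongly convex in w for every φ with 0 < μ < L, and α = μ/L². Set δ := 1 − μ²/L². Then for every N ≥ 1 and all (w₁,φ₁), (w₂,φ₂) ∈ W × Φ: ‖G_w(w₁,φ₁) − G_w(w₂,φ₂)‖ ≤ (δ^{3N/2} L + (2ρM/μ) δ^{N−1}) ‖w₁ − w₂‖ + (δ^N L + αρMN δ^{N−1})(2L/μ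 + 1) ‖φ₁ − φ₂‖. -/
noncomputable section

open scoped RealInnerProductSpace

lemma aux_sqrt_le {a b : ℝ} (ha : 0 ≤ a) (hb : 0 ≤ b) : Real.sqrt (a ^ 2 + b ^ 2) ≤ a + b := by
  apply Real.sqrt_le_iff.mpr
  constructor
  · positivity
  · nlinarith [mul_nonneg ha hb]

lemma aux_gradW_inner {p q : ℕ} {f : Wsp p × Wsp q → ℝ} (w : Wsp p) (φ : Wsp q) (v : Wsp p) :
    ⟪gradW f w φ, v⟫ = fderiv ℝ (fun u => f (u, φ)) w v := by
  simp [gradW, gradient]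

lemma aux_slice {p q : ℕ} {f : Wsp p × Wsp q → ℝ} (hf : ContDiff ℝ 2 f) (φ : Wsp q) :
    ContDiff ℝ 2 (fun u => f (u, φ)) := by
  fun_prop

lemma aux_fderiv_diff {p q : ℕ} {f : Wsp p × Wsp q → ℝ} (hf : ContDiff ℝ 2 f) (φ : Wsp q) :
    Differentiable ℝ (fderiv ℝ (fun u => f (u, φ))) := by
  have h := (aux_slice hf φ).fderiv_right (m := 1) (by norm_num)
  exact h.differentiable (by norm_num)

lemma aux_gradW_diff {p q : ℕ} {f : Wsp p × Wsp q → ℝ} (hf : ContDiff ℝ 2 f) (φ : Wsp q) :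
    Differentiable ℝ (fun u => gradW f u φ) := by
  have h := aux_fderiv_diff hf φ
  intro u
  exact ((InnerProductSpace.toDual ℝ (Wsp p)).symm.toContinuousLinearEquiv.differentiable _).comp u (h u)

lemma aux_hess {p q : ℕ} {f : Wsp p × Wsp q → ℝ} (hf : ContDiff ℝ 2 f) (w : Wsp p) (φ : Wsp q) :
    HasFDerivAt (fun u => gradW f u φ) (hessW f w φ) w :=
  (aux_gradW_diff hf φ w).hasFDerivAt

lemma aux_hess_inner {p q : ℕ} {f : Wsp p × Wsp q → ℝ} (hf : ContDiff ℝ 2 f) (w : Wsp p) (φ : Wsp q)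
    (x y : Wsp p) :
    ⟪hessW f w φ x, y⟫ = fderiv ℝ (fderiv ℝ (fun u => f (u, φ))) w x y := by
  have h1 : HasFDerivAt (fun u => ⟪gradW f u φ, y⟫) ((innerSL ℝ y).comp (hessW f w φ)) w := by
    have := (innerSL ℝ y).hasFDerivAt.comp w (aux_hess hf w φ)
    refine this.congr_of_eventuallyEq (Filter.Eventually.of_forall fun u => ?_)
    simp [real_inner_comm]
  have h2 : HasFDerivAt (fun u => fderiv ℝ (fun u => f (u, φ)) u y)
      ((ContinuousLinearMap.apply ℝ ℝ y).comp (fderiv ℝ (fderiv ℝ (fun u => f (u, φ))) w)) w :=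
    (ContinuousLinearMap.apply ℝ ℝ y).hasFDerivAt.comp w (aux_fderiv_diff hf φ w).hasFDerivAt
  have h3 := h1.congr_of_eventuallyEq (f₁ := fun u => fderiv ℝ (fun u => f (u, φ)) u y)
    (Filter.Eventually.of_forall fun u => (aux_gradW_inner u φ y).symm)
  have h4 := congrArg (fun T => T x) (h3.unique h2)
  simp only [ContinuousLinearMap.comp_apply, innerSL_apply_apply, ContinuousLinearMap.apply_apply] at h4
  rw [real_inner_comm]; exact h4

lemma aux_hess_symm {p q : ℕ} {f : Wsp p × Wsp q → ℝ} (hf : ContDiff ℝ 2 f) (w : Wsp p) (φ : Wsp q)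
    (x y : Wsp p) : ⟪hessW f w φ x, y⟫ = ⟪hessW f w φ y, x⟫ := by
  rw [aux_hess_inner hf, aux_hess_inner hf]
  have h := (aux_slice hf φ).contDiffAt.isSymmSndFDerivAt (x := w) (by simp)
  exact h x y

lemma aux_gradLip {p q : ℕ} {L : ℝ} {f : Wsp p × Wsp q → ℝ} (hL : 0 ≤ L) (h : GradLip L f)
    (w₁ w₂ : Wsp p) (φ₁ φ₂ : Wsp q) :
    ‖gradW f w₁ φ₁ - gradW f w₂ φ₂‖ ≤ L * (‖w₁ - w₂‖ + ‖φ₁ - φ₂‖) := by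
  calc ‖gradW f w₁ φ₁ - gradW f w₂ φ₂‖
      ≤ Real.sqrt (‖gradW f w₁ φ₁ - gradW f w₂ φ₂‖ ^ 2
          + ‖gradPhi f w₁ φ₁ - gradPhi f w₂ φ₂‖ ^ 2) := by
        apply Real.le_sqrt_of_sq_le
        nlinarith [sq_nonneg ‖gradPhi f w₁ φ₁ - gradPhi f w₂ φ₂‖]
    _ ≤ _ := h w₁ w₂ φ₁ φ₂
    _ ≤ _ := mul_le_mul_of_nonneg_left (aux_sqrt_le (norm_nonneg _) (norm_nonneg _)) hL

lemma aux_hess_norm {p q : ℕ} {L : ℝ} {f : Wsp p × Wsp q → ℝ} (hf : ContDiff ℝ 2 f) (hL : 0 ≤ L)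
    (h : GradLip L f) (w : Wsp p) (φ : Wsp q) : ‖hessW f w φ‖ ≤ L := by
  refine (aux_hess hf w φ).le_of_lip' hL (Filter.Eventually.of_forall fun u => ?_)
  simpa using aux_gradLip hL h u w φ φ

lemma aux_gradW_norm {p q : ℕ} {M : ℝ} {f : Wsp p × Wsp q → ℝ} (hf : ContDiff ℝ 2 f) (hM : 0 ≤ M)
    (h : FunLip M f) (w : Wsp p) (φ : Wsp q) : ‖gradW f w φ‖ ≤ M := by
  have hd : HasFDerivAt (fun u => f (u, φ)) (fderiv ℝ (fun u => f (u, φ)) w) w :=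
    ((aux_slice hf φ).differentiable (by norm_num) w).hasFDerivAt
  have := hd.le_of_lip' hM (Filter.Eventually.of_forall fun u => by
    have := h u w φ φ
    rw [Real.norm_eq_abs]
    simpa using this)
  simpa [gradW, gradient] using this

lemma aux_hess_lower {p q : ℕ} {μc : ℝ} {f : Wsp p × Wsp q → ℝ} (hf : ContDiff ℝ 2 f)
    (h : StrongConvexIn μc f) (w : Wsp p) (φ : Wsp q) (v : Wsp p) :
    μc * ‖v‖ ^ 2 ≤ ⟪hessW f w φ v, v⟫ := by
  have hmono : ∀ x y : Wsp p, μc * ‖x - y‖ ^ 2 ≤ ⟪gradW f x φ - gradW f y φ, x - y⟫ := by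
    intro x y
    have h1 := h x y φ
    have h2 := h y x φ
    rw [norm_sub_rev y x] at h2
    have e1 : ⟪y - x, gradW f x φ⟫ = - ⟪gradW f x φ, x - y⟫ := by
      rw [← neg_sub x y, inner_neg_left, real_inner_comm]
    have e2 : ⟪x - y, gradW f y φ⟫ = ⟪gradW f y φ, x - y⟫ := real_inner_comm _ _
    rw [inner_sub_left]
    rw [e1] at h1; rw [e2] at h2
    linarith
  have hl := ((aux_hess hf w φ).hasLineDerivAt v)
  have hs := hl.tendsto_slope_zero_right
  have hs2 := (Filter.Tendsto.inner (𝕜 := ℝ) hs (tendsto_const_nhds (x := v)))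
  refine ge_of_tendsto hs2 ?_
  filter_upwards [self_mem_nhdsWithin] with t ht
  have ht : 0 < t := ht
  have := hmono (w + t • v) w
  simp only [add_sub_cancel_left, norm_smul, inner_smul_right, Real.norm_eq_abs, abs_of_pos ht] at this
  rw [real_inner_smul_left, inv_mul_eq_div, le_div_iff₀ ht]
  have h3 : t * (μc * ‖v‖ ^ 2 * t) ≤ t * ⟪gradW f (w + t • v) φ - gradW f w φ, v⟫ := by linarith
  exact le_of_mul_le_mul_left h3 ht

lemma aux_symm_norm {E : Type*} [NormedAddCommGroup E] [InnerProductSpace ℝ E] (A : E →L[ℝ] E) (c : ℝ)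
    (hc : 0 ≤ c) (hs : ∀ x y, ⟪A x, y⟫ = ⟪A y, x⟫) (hq : ∀ x, |⟪A x, x⟫| ≤ c * ‖x‖ ^ 2) : ‖A‖ ≤ c := by
  have key : ∀ x y, 2 * ⟪A x, y⟫ ≤ c * (‖x‖ ^ 2 + ‖y‖ ^ 2) := by
    intro x y
    have h1 := (abs_le.mp (hq (x + y))).2
    have h2 := (abs_le.mp (hq (x - y))).1
    have h3 := parallelogram_law_with_norm ℝ x y
    simp only [map_add, map_sub, inner_add_left, inner_add_right, inner_sub_left, inner_sub_right] at h1 h2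
    have := hs x y
    have h4 : c * ‖x + y‖ ^ 2 + c * ‖x - y‖ ^ 2 = 2 * (c * (‖x‖ ^ 2 + ‖y‖ ^ 2)) := by
      linear_combination c * h3
    linarith
  refine A.opNorm_le_bound hc fun x => ?_
  by_cases hx : ‖x‖ = 0
  · have : x = 0 := norm_eq_zero.mp hx
    simp [this]
  by_cases hy : ‖A x‖ = 0
  · rw [hy]; positivity
  have hx' : 0 < ‖x‖ := lt_of_le_of_ne (norm_nonneg _) (Ne.symm hx)
  have hy' : 0 < ‖A x‖ := lt_of_le_of_ne (norm_nonneg _) (Ne.symm hy)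
  have h := key x ((‖x‖ / ‖A x‖) • A x)
  rw [inner_smul_right, real_inner_self_eq_norm_sq, norm_smul, Real.norm_eq_abs,
    abs_of_pos (by positivity)] at h
  have e1 : ‖x‖ / ‖A x‖ * ‖A x‖ ^ 2 = ‖x‖ * ‖A x‖ := by field_simp
  have e2 : ‖x‖ / ‖A x‖ * ‖A x‖ = ‖x‖ := by field_simp
  rw [e1, e2] at h
  have h3 : ‖x‖ * ‖A x‖ ≤ ‖x‖ * (c * ‖x‖) := by nlinarith
  exact le_of_mul_le_mul_left h3 hx'

lemma aux_step_norm {p q : ℕ} {f : Wsp p × Wsp q → ℝ} (hf : ContDiff ℝ 2 f) {L μc α δ : ℝ}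
    (hLip : GradLip L f) (hSC : StrongConvexIn μc f)
    (hμ : 0 < μc) (hμL : μc < L) (hα : α = μc / L ^ 2) (hδ : δ = 1 - μc ^ 2 / L ^ 2)
    (w : Wsp p) (φ : Wsp q) :
    ‖ContinuousLinearMap.id ℝ (Wsp p) - α • hessW f w φ‖ ≤ δ := by
  have hL : 0 < L := hμ.trans hμL
  have hα0 : 0 < α := by rw [hα]; positivity
  have hδ' : δ = 1 - α * μc := by rw [hδ, hα]; ring
  have hαL : α * L ≤ 1 := by
    rw [hα, div_mul_eq_mul_div, div_le_one (by positivity)]; nlinarith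
  have hδ0 : 0 ≤ δ := by rw [hδ']; nlinarith
  apply aux_symm_norm _ _ hδ0
  · intro x y
    simp only [ContinuousLinearMap.sub_apply, ContinuousLinearMap.smul_apply,
      ContinuousLinearMap.id_apply, inner_sub_left, real_inner_smul_left]
    rw [aux_hess_symm hf w φ x y, real_inner_comm]
  · intro x
    simp only [ContinuousLinearMap.sub_apply, ContinuousLinearMap.smul_apply,
      ContinuousLinearMap.id_apply, inner_sub_left, real_inner_smul_left, real_inner_self_eq_norm_sq]
    have h1 := aux_hess_lower hf hSC w φ x
    have h2 : ⟪hessW f w φ x, x⟫ ≤ L * ‖x‖ ^ 2 := by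
      calc _ ≤ ‖hessW f w φ x‖ * ‖x‖ := real_inner_le_norm _ _
        _ ≤ (L * ‖x‖) * ‖x‖ := by
          gcongr
          exact (hessW f w φ).le_of_opNorm_le (aux_hess_norm hf hL.le hLip w φ) x
        _ = _ := by ring
    have h1' := mul_le_mul_of_nonneg_left h1 hα0.le
    have h2' := mul_le_mul_of_nonneg_left h2 hα0.le
    have h3 := mul_le_mul_of_nonneg_right hαL (sq_nonneg ‖x‖)
    have h4 := mul_nonneg hδ0 (sq_nonneg ‖x‖)
    rw [hδ'] at h4 ⊢
    rw [abs_le]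
    constructor <;> nlinarith

/-- Jacobian of the inner iterates. -/
def jacIter {p q : ℕ} (f : Wsp p × Wsp q → ℝ) (α : ℝ) : ℕ → Wsp p → Wsp q → (Wsp p →L[ℝ] Wsp p)
  | 0, _, _ => ContinuousLinearMap.id ℝ (Wsp p)
  | (m+1), w, φ => (ContinuousLinearMap.id ℝ (Wsp p) - α • hessW f (innerIter f α m w φ) φ).comp
      (jacIter f α m w φ)

lemma aux_step_deriv {p q : ℕ} {f : Wsp p × Wsp q → ℝ} (hf : ContDiff ℝ 2 f) (α : ℝ)
    (w : Wsp p) (φ : Wsp q) :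
    HasFDerivAt (fun u => u - α • gradW f u φ)
      (ContinuousLinearMap.id ℝ (Wsp p) - α • hessW f w φ) w :=
  (hasFDerivAt_id w).sub ((aux_hess hf w φ).const_smul α)

lemma aux_jac {p q : ℕ} {f : Wsp p × Wsp q → ℝ} (hf : ContDiff ℝ 2 f) (α : ℝ) (m : ℕ)
    (w : Wsp p) (φ : Wsp q) :
    HasFDerivAt (fun u => innerIter f α m u φ) (jacIter f α m w φ) w := by
  induction m with
  | zero => exact hasFDerivAt_id w
  | succ m ih => exact (aux_step_deriv hf α (innerIter f α m w φ) φ).comp w ih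

lemma aux_grad_inner {p q : ℕ} {f g : Wsp p × Wsp q → ℝ} (hf : ContDiff ℝ 2 f) (hg : ContDiff ℝ 2 g)
    (α : ℝ) (m : ℕ) (w : Wsp p) (φ : Wsp q) (v : Wsp p) :
    ⟪gradient (fun u => g (innerIter f α m u φ, φ)) w, v⟫
      = ⟪gradW g (innerIter f α m w φ) φ, jacIter f α m w φ v⟫ := by
  have hd : HasFDerivAt (fun u => g (u, φ))
      (fderiv ℝ (fun u => g (u, φ)) (innerIter f α m w φ)) (innerIter f α m w φ) :=
    ((aux_slice hg φ).differentiable (by norm_num) _).hasFDerivAt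
  have h := (hd.comp w (aux_jac hf α m w φ)).fderiv
  rw [aux_gradW_inner]
  have e : (fun u => g (innerIter f α m u φ, φ))
    = (fun u => g (u, φ)) ∘ (fun u => innerIter f α m u φ) := rfl
  rw [gradient, InnerProductSpace.toDual_symm_apply, e, h]
  rfl

/-- Proposition 2, part 1: smoothness of the task meta-gradient in `w`
under a strongly-convex inner loop with `α = μ/L²` and `δ = 1 - μ²/L²`. -/
theorem anil_meta_grad_w_smooth_sc (p q : ℕ) (LS LD : Wsp p × Wsp q → ℝ)
    (hLS : ContDiff ℝ 2 LS) (hLD : ContDiff ℝ 2 LD) (L M ρ μc α δ : ℝ)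
    (hLipS : GradLip L LS) (hLipD : GradLip L LD) (hFunD : FunLip M LD)
    (hHess : HessLip ρ LS) (hSC : StrongConvexIn μc LS)
    (hμ : 0 < μc) (hμL : μc < L) (hα : α = μc / L ^ 2) (hδ : δ = 1 - μc ^ 2 / L ^ 2) :
    ∀ (N : ℕ), 1 ≤ N → ∀ (w₁ w₂ : Wsp p) (φ₁ φ₂ : Wsp q),
      ‖gradient (fun u => LD (innerIter LS α N u φ₁, φ₁)) w₁
          - gradient (fun u => LD (innerIter LS α N u φ₂, φ₂)) w₂‖
        ≤ (δ ^ ((3 * (N : ℝ)) / 2) * L + (2 * ρ * M / μc) * δ ^ (N - 1)) * ‖w₁ - w₂‖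
          + (δ ^ N * L + α * ρ * M * N * δ ^ (N - 1)) * (2 * L / μc + 1) * ‖φ₁ - φ₂‖ := by
  intro N hN w₁ w₂ φ₁ φ₂
  by_cases htriv : w₁ = w₂ ∧ φ₁ = φ₂
  · obtain ⟨rfl, rfl⟩ := htriv
    simp
  have hL : 0 < L := hμ.trans hμL
  have hα0 : 0 < α := by rw [hα]; positivity
  have hδα : δ = 1 - α * μc := by rw [hδ, hα]; ring
  have hδ0 : 0 < δ := by
    rw [hδ, sub_pos, div_lt_one (by positivity)]
    nlinarith
  have hδ1 : δ ≤ 1 := by rw [hδα]; nlinarith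
  have hαL2 : α * L ^ 2 = μc := by rw [hα]; field_simp
  have hpos : 0 < Real.sqrt (‖w₁ - w₂‖ ^ 2 + ‖φ₁ - φ₂‖ ^ 2) := by
    apply Real.sqrt_pos.mpr
    by_cases hw : w₁ = w₂
    · have hφ : φ₁ - φ₂ ≠ 0 := sub_ne_zero.mpr fun h => htriv ⟨hw, h⟩
      have := norm_pos_iff.mpr hφ
      positivity
    · have := norm_pos_iff.mpr (sub_ne_zero.mpr hw)
      positivity
  have hM : 0 ≤ M := nonneg_of_mul_nonneg_left ((abs_nonneg _).trans (hFunD w₁ w₂ φ₁ φ₂)) hpos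
  have hρ : 0 ≤ ρ := nonneg_of_mul_nonneg_left ((norm_nonneg _).trans (hHess w₁ w₂ φ₁ φ₂)) hpos
  obtain ⟨a, ha⟩ : ∃ a, a = ‖w₁ - w₂‖ := ⟨_, rfl⟩
  obtain ⟨b, hb⟩ : ∃ b, b = ‖φ₁ - φ₂‖ := ⟨_, rfl⟩
  have ha0 : 0 ≤ a := ha ▸ norm_nonneg _
  have hb0 : 0 ≤ b := hb ▸ norm_nonneg _
  have hstep := aux_step_norm hLS hLipS hSC hμ hμL hα hδ
  -- contraction of one step
  have hcontr : ∀ (φ : Wsp q) (x y : Wsp p),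
      ‖(x - α • gradW LS x φ) - (y - α • gradW LS y φ)‖ ≤ δ * ‖x - y‖ := by
    intro φ x y
    exact Convex.norm_image_sub_le_of_norm_hasFDerivWithin_le (s := Set.univ)
      (f := fun u => u - α • gradW LS u φ)
      (fun u _ => (aux_step_deriv hLS α u φ).hasFDerivWithinAt) (fun u _ => hstep u φ)
      convex_univ (Set.mem_univ y) (Set.mem_univ x)
  have hcoef : δ * (L / μc) + α * L = L / μc := by
    rw [hδα]; field_simp; ring
  have hiter : ∀ m, ‖innerIter LS α m w₁ φ₁ - innerIter LS α m w₂ φ₂‖ ≤ δ ^ m * a + L / μc * b := by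
    intro m
    induction m with
    | zero =>
      simp only [innerIter, pow_zero, one_mul, ← ha]
      have : 0 ≤ L / μc * b := by positivity
      linarith
    | succ m ih =>
      simp only [innerIter]
      set x := innerIter LS α m w₁ φ₁
      set y := innerIter LS α m w₂ φ₂
      have h1 := hcontr φ₁ x y
      have h2 := aux_gradLip hL.le hLipS y y φ₁ φ₂
      rw [sub_self, norm_zero, zero_add, ← hb] at h2
      have e : x - α • gradW LS x φ₁ - (y - α • gradW LS y φ₂)
        = ((x - α • gradW LS x φ₁) - (y - α • gradW LS y φ₁))
          - α • (gradW LS y φ₁ - gradW LS y φ₂) := by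
        rw [smul_sub]; abel
      rw [e]
      calc _ ≤ δ * ‖x - y‖ + α * ‖gradW LS y φ₁ - gradW LS y φ₂‖ := by
            refine (norm_sub_le _ _).trans ?_
            rw [norm_smul α, Real.norm_eq_abs, abs_of_pos hα0]
            linarith
        _ ≤ δ * (δ ^ m * a + L / μc * b) + α * (L * b) := by gcongr
        _ = δ ^ (m + 1) * a + (δ * (L / μc) + α * L) * b := by ring
        _ = _ := by rw [hcoef]
  have hjn : ∀ m (w : Wsp p) (φ : Wsp q), ‖jacIter LS α m w φ‖ ≤ δ ^ m := by
    intro m w φ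
    induction m with
    | zero => simpa [jacIter] using ContinuousLinearMap.norm_id_le
    | succ m ih =>
      rw [jacIter, pow_succ']
      refine (ContinuousLinearMap.opNorm_comp_le _ _).trans ?_
      exact mul_le_mul (hstep _ _) ih (norm_nonneg _) hδ0.le
  have hrec : ∀ m, ‖jacIter LS α (m + 1) w₁ φ₁ - jacIter LS α (m + 1) w₂ φ₂‖
      ≤ δ * ‖jacIter LS α m w₁ φ₁ - jacIter LS α m w₂ φ₂‖
        + δ ^ m * (α * ρ * (δ ^ m * a + (L / μc + 1) * b)) := by
    intro m
    simp only [jacIter]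
    have hi := hiter m
    set x := innerIter LS α m w₁ φ₁
    set y := innerIter LS α m w₂ φ₂
    set J₁ := jacIter LS α m w₁ φ₁
    set J₂ := jacIter LS α m w₂ φ₂
    have hj : ‖J₂‖ ≤ δ ^ m := hjn m w₂ φ₂
    have hH : ‖hessW LS x φ₁ - hessW LS y φ₂‖ ≤ ρ * (δ ^ m * a + (L / μc + 1) * b) := by
      refine (hHess x y φ₁ φ₂).trans ?_
      gcongr
      refine (aux_sqrt_le (norm_nonneg _) (norm_nonneg _)).trans ?_
      rw [← hb]; linarith
    have e : (ContinuousLinearMap.id ℝ (Wsp p) - α • hessW LS x φ₁).comp J₁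
        - (ContinuousLinearMap.id ℝ (Wsp p) - α • hessW LS y φ₂).comp J₂
        = (ContinuousLinearMap.id ℝ (Wsp p) - α • hessW LS x φ₁).comp (J₁ - J₂)
          - (α • (hessW LS x φ₁ - hessW LS y φ₂)).comp J₂ := by
      ext1 v
      simp only [ContinuousLinearMap.sub_apply, ContinuousLinearMap.comp_apply,
        ContinuousLinearMap.smul_apply, ContinuousLinearMap.id_apply, map_sub, smul_sub]
      abel
    rw [e]
    refine (norm_sub_le _ _).trans (add_le_add ?_ ?_)
    · refine (ContinuousLinearMap.opNorm_comp_le _ _).trans ?_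
      exact mul_le_mul_of_nonneg_right (hstep _ _) (norm_nonneg _)
    · refine (ContinuousLinearMap.opNorm_comp_le _ _).trans ?_
      rw [norm_smul α, Real.norm_eq_abs, abs_of_pos hα0]
      calc _ ≤ (α * (ρ * (δ ^ m * a + (L / μc + 1) * b))) * δ ^ m := by gcongr
        _ = _ := by ring
  have hαd : ∀ m : ℕ, (1 - δ ^ m) / μc + α * δ ^ m = (1 - δ ^ (m + 1)) / μc := by
    intro m
    rw [pow_succ]
    field_simp
    rw [hδα]; ring
  have hX : ∀ m : ℕ, δ * ‖jacIter LS α m w₁ φ₁ - jacIter LS α m w₂ φ₂‖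
      ≤ δ ^ m * (ρ * ((1 - δ ^ m) / μc * a + α * m * (L / μc + 1) * b)) := by
    intro m
    induction m with
    | zero => simp [jacIter]
    | succ m ih =>
      have h := hrec m
      calc _ ≤ δ * (δ ^ m * (ρ * ((1 - δ ^ m) / μc * a + α * m * (L / μc + 1) * b))
              + δ ^ m * (α * ρ * (δ ^ m * a + (L / μc + 1) * b))) := by
            gcongr; linarith
        _ = δ ^ (m + 1) * (ρ * (((1 - δ ^ m) / μc + α * δ ^ m) * a
              + α * (m + 1) * (L / μc + 1) * b)) := by ring
        _ = _ := by rw [hαd]; push_cast; rfl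
  obtain ⟨n, rfl⟩ : ∃ n, N = n + 1 := ⟨N - 1, by omega⟩
  have hJ : ‖jacIter LS α (n + 1) w₁ φ₁ - jacIter LS α (n + 1) w₂ φ₂‖
      ≤ δ ^ n * (ρ * (1 / μc * a + α * ((n + 1 : ℕ) : ℝ) * (L / μc + 1) * b)) := by
    have h := hX (n + 1)
    rw [pow_succ' δ n, mul_assoc δ] at h
    refine (le_of_mul_le_mul_left h hδ0).trans ?_
    gcongr
    have : 0 ≤ δ * δ ^ n := by positivity
    linarith
  have hG : ‖gradW LD (innerIter LS α (n + 1) w₁ φ₁) φ₁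
      - gradW LD (innerIter LS α (n + 1) w₂ φ₂) φ₂‖
      ≤ L * (δ ^ (n + 1) * a + (L / μc + 1) * b) := by
    refine (aux_gradLip hL.le hLipD _ _ _ _).trans ?_
    refine mul_le_mul_of_nonneg_left ?_ hL.le
    rw [← hb]; linarith [hiter (n + 1)]
  have hGM := aux_gradW_norm hLD hM hFunD (innerIter LS α (n + 1) w₂ φ₂) φ₂
  have hj1 := hjn (n + 1) w₁ φ₁
  set T : ℝ := δ ^ (n + 1) * (L * (δ ^ (n + 1) * a + (L / μc + 1) * b))
    + M * (δ ^ n * (ρ * (1 / μc * a + α * ((n + 1 : ℕ) : ℝ) * (L / μc + 1) * b))) with hT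
  have hT0 : 0 ≤ T := by positivity
  have hmain : ‖gradient (fun u => LD (innerIter LS α (n + 1) u φ₁, φ₁)) w₁
          - gradient (fun u => LD (innerIter LS α (n + 1) u φ₂, φ₂)) w₂‖ ≤ T := by
    set v := gradient (fun u => LD (innerIter LS α (n + 1) u φ₁, φ₁)) w₁
          - gradient (fun u => LD (innerIter LS α (n + 1) u φ₂, φ₂)) w₂ with hv
    have hself : ⟪v, v⟫ ≤ T * ‖v‖ := by
      have e : ⟪v, v⟫ = ⟪gradient (fun u => LD (innerIter LS α (n + 1) u φ₁, φ₁)) w₁, v⟫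
        - ⟪gradient (fun u => LD (innerIter LS α (n + 1) u φ₂, φ₂)) w₂, v⟫ := by
        rw [← inner_sub_left]
      rw [e, aux_grad_inner hLS hLD, aux_grad_inner hLS hLD]
      clear_value v
      set g₁ := gradW LD (innerIter LS α (n + 1) w₁ φ₁) φ₁
      set g₂ := gradW LD (innerIter LS α (n + 1) w₂ φ₂) φ₂
      set J₁ := jacIter LS α (n + 1) w₁ φ₁
      set J₂ := jacIter LS α (n + 1) w₂ φ₂
      have e2 : ⟪g₁, J₁ v⟫ - ⟪g₂, J₂ v⟫ = ⟪g₁ - g₂, J₁ v⟫ + ⟪g₂, (J₁ - J₂) v⟫ := by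
        rw [ContinuousLinearMap.sub_apply, inner_sub_left, inner_sub_right]; ring
      rw [e2]
      have b1 := J₁.le_of_opNorm_le hj1 v
      have b2 := (J₁ - J₂).le_of_opNorm_le hJ v
      calc _ ≤ ‖g₁ - g₂‖ * ‖J₁ v‖ + ‖g₂‖ * ‖(J₁ - J₂) v‖ :=
            add_le_add (real_inner_le_norm _ _) (real_inner_le_norm _ _)
        _ ≤ (L * (δ ^ (n + 1) * a + (L / μc + 1) * b)) * (δ ^ (n + 1) * ‖v‖)
            + M * (δ ^ n * (ρ * (1 / μc * a + α * ((n + 1 : ℕ) : ℝ) * (L / μc + 1) * b)) * ‖v‖) := by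
            gcongr
        _ = T * ‖v‖ := by rw [hT]; ring
    rw [real_inner_self_eq_norm_sq] at hself
    clear_value v
    by_cases hv0 : ‖v‖ = 0
    · rw [hv0]; exact hT0
    · have : 0 < ‖v‖ := lt_of_le_of_ne (norm_nonneg _) (Ne.symm hv0)
      nlinarith
  refine hmain.trans ?_
  rw [← ha, ← hb, Nat.add_sub_cancel]
  have hpow : δ ^ (n + 1) * δ ^ (n + 1) ≤ δ ^ ((3 * ((n + 1 : ℕ) : ℝ)) / 2) := by
    rw [← pow_add, ← Real.rpow_natCast]
    apply Real.rpow_le_rpow_of_exponent_ge hδ0 hδ1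
    push_cast
    have : (0 : ℝ) ≤ n := Nat.cast_nonneg n
    linarith
  have hLμ : 0 ≤ L / μc := by positivity
  have hD1 : 0 ≤ δ ^ (n + 1) * L + α * ρ * M * ((n + 1 : ℕ) : ℝ) * δ ^ n := by positivity
  have hr : 0 ≤ ρ * M / μc * δ ^ n := by positivity
  calc T = (δ ^ (n + 1) * δ ^ (n + 1) * L + ρ * M / μc * δ ^ n) * a
        + (δ ^ (n + 1) * L + α * ρ * M * ((n + 1 : ℕ) : ℝ) * δ ^ n) * (L / μc + 1) * b := by
        rw [hT]; ring
    _ ≤ (δ ^ ((3 * ((n + 1 : ℕ) : ℝ)) / 2) * L + (2 * ρ * M / μc) * δ ^ n) * a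
        + (δ ^ (n + 1) * L + α * ρ * M * ((n + 1 : ℕ) : ℝ) * δ ^ n) * (2 * L / μc + 1) * b := by
        have e3 : 2 * ρ * M / μc * δ ^ n = 2 * (ρ * M / μc * δ ^ n) := by ring
        have e4 : 2 * L / μc = 2 * (L / μc) := by ring
        have h5 : ρ * M / μc * δ ^ n ≤ 2 * ρ * M / μc * δ ^ n := by rw [e3]; linarith
        have h6 : L / μc ≤ 2 * L / μc := by rw [e4]; linarith
        gcongr
end
end

section
/- Suppose the gradient of L_S is L-Lipschitz on W × Φ and α > 0. Then for every N ∈ ℕ and all (w₁,φ₁), (w₂,φ₂) ∈ W × Φ: ‖w_N(w₁,φ₁) − w_N(w₂,φ₂)‖ ≤ (1 + αL)^N ‖w₁ − w₂‖ + ((1 + αL)^N − 1) ‖φ₁ − φ₂‖. -/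
noncomputable section

open scoped RealInnerProductSpace

/-- growth bound on the inner-loop iterates when the inner-loop loss is
only smooth (possibly nonconvex). -/
theorem anil_inner_iterates_nonconvex (p q : ℕ) (LS : Wsp p × Wsp q → ℝ)
    (hLS : ContDiff ℝ 1 LS) (L α : ℝ) (hLip : GradLip L LS) (hα : 0 < α) :
    ∀ (N : ℕ) (w₁ w₂ : Wsp p) (φ₁ φ₂ : Wsp q),
      ‖innerIter LS α N w₁ φ₁ - innerIter LS α N w₂ φ₂‖
        ≤ (1 + α * L) ^ N * ‖w₁ - w₂‖ + ((1 + α * L) ^ N - 1) * ‖φ₁ - φ₂‖ := by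
  intro N w₁ w₂ φ₁ φ₂
  by_cases hL : 0 ≤ L
  · have hb : 0 ≤ α * L := mul_nonneg hα.le hL
    have key : ∀ (u v : Wsp p), ‖gradW LS u φ₁ - gradW LS v φ₂‖
        ≤ L * (‖u - v‖ + ‖φ₁ - φ₂‖) := by
      intro u v
      have h1 : ‖gradW LS u φ₁ - gradW LS v φ₂‖ ≤ Real.sqrt (‖gradW LS u φ₁ - gradW LS v φ₂‖ ^ 2
          + ‖gradPhi LS u φ₁ - gradPhi LS v φ₂‖ ^ 2) :=
        Real.le_sqrt_of_sq_le (le_add_of_nonneg_right (sq_nonneg _))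
      have h2 : Real.sqrt (‖u - v‖ ^ 2 + ‖φ₁ - φ₂‖ ^ 2) ≤ ‖u - v‖ + ‖φ₁ - φ₂‖ := by
        apply Real.sqrt_le_iff.mpr
        refine ⟨by positivity, ?_⟩
        nlinarith [mul_nonneg (norm_nonneg (u - v)) (norm_nonneg (φ₁ - φ₂))]
      exact h1.trans ((hLip u v φ₁ φ₂).trans (mul_le_mul_of_nonneg_left h2 hL))
    induction N with
    | zero => simp [innerIter]
    | succ m ih =>
      simp only [innerIter]
      set u := innerIter LS α m w₁ φ₁
      set v := innerIter LS α m w₂ φ₂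
      have h3 : u - α • gradW LS u φ₁ - (v - α • gradW LS v φ₂)
          = (u - v) - α • (gradW LS u φ₁ - gradW LS v φ₂) := by
        rw [smul_sub]; abel
      rw [h3]
      have h4 := norm_sub_le (u - v) (α • (gradW LS u φ₁ - gradW LS v φ₂))
      rw [norm_smul, Real.norm_of_nonneg hα.le] at h4
      have h5 := mul_le_mul_of_nonneg_left (key u v) hα.le
      have h6 := mul_le_mul_of_nonneg_left ih (by linarith : 0 ≤ 1 + α * L)
      rw [pow_succ]
      linarith
  · have hL' : L < 0 := not_le.mp hL
    have key : ∀ (u v : Wsp p) (a b : Wsp q), ‖u - v‖ = 0 ∧ ‖a - b‖ = 0 := by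
      intro u v a b
      have h := (Real.sqrt_nonneg _).trans (hLip u v a b)
      have h0 : Real.sqrt (‖u - v‖ ^ 2 + ‖a - b‖ ^ 2) ≤ 0 := by
        by_contra hc
        exact absurd h (not_le.mpr (mul_neg_of_neg_of_pos hL' (not_le.mp hc)))
      have h1 := Real.sqrt_eq_zero'.mp (le_antisymm h0 (Real.sqrt_nonneg _))
      have h2 := sq_nonneg ‖u - v‖
      have h3 := sq_nonneg ‖a - b‖
      exact ⟨pow_eq_zero_iff two_ne_zero |>.mp (by linarith),
        pow_eq_zero_iff two_ne_zero |>.mp (by linarith)⟩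
    rw [(key w₁ w₂ φ₁ φ₂).1, (key w₁ w₂ φ₁ φ₂).2, (key _ _ φ₁ φ₂).1]
    simp
end
end
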